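/- arXiv:1401.6788 — 6 statements merged into one kernel-verified Lean document; each statement's English description precedes it below -/
import Mathlib

section
/- Fix integers n ≥ 1 and r ≥ 2, and let B be the (n+1)×(n+1) integer matrix, indexed by {0,1,…,n}, with entries B_{kN} = binom(r*N, k). Then the determinant of B is nonzero (so B is invertible as a matrix over ℚ), but B is not invertible over ℤ, i.e. det B is neither 1 nor -1. -/
open Matrix in
/-- Multiplying the `j`-th column by `j!` turns binomial coefficients into falling factorials,
which have the same determinant as the Vandermonde matrix. -/
theorem superFactorial_mul_det_choose (n : ℕ) (v : Fin (n + 1) → ℕ) :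
    (n.superFactorial : ℤ) * (of fun i j : Fin (n + 1) => ((v i).choose (j : ℕ) : ℤ)).det =
      (vandermonde fun i => (v i : ℤ)).det := by
  rw [det_eval_matrixOfPolynomials_eq_det_vandermonde (fun i => (v i : ℤ))
    (fun j => descPochhammer ℤ j) (fun j => descPochhammer_natDegree ℤ j)
    (fun j => monic_descPochhammer ℤ j)]
  have h : (n.superFactorial : ℤ) = ∏ j : Fin (n + 1), ((j : ℕ).factorial : ℤ) := by
    rw [Fin.prod_univ_eq_prod_range (fun j => (j.factorial : ℤ)) (n + 1),
      ← Nat.prod_range_succ_factorial]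
    push_cast
    rfl
  rw [h, ← det_mul_row]
  congr 1
  ext i j
  simp only [of_apply, descPochhammer_eval_eq_descFactorial,
    Nat.descFactorial_eq_factorial_mul_choose, Nat.cast_mul]

open Matrix in
/-- Scaling the nodes by `r` multiplies the determinant of binomial coefficients at
`0, …, n` by a power of `r`. -/
theorem det_choose_mul (n r : ℕ) :
    (of fun i j : Fin (n + 1) => ((r * (i : ℕ)).choose (j : ℕ) : ℤ)).det =
      (r : ℤ) ^ ∑ j : Fin (n + 1), (j : ℕ) := by
  have hsf : (n.superFactorial : ℤ) ≠ 0 := by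
    rw [← Nat.prod_range_succ_factorial]
    exact_mod_cast Finset.prod_ne_zero_iff.mpr fun k _ => Nat.factorial_ne_zero _
  apply mul_left_cancel₀ hsf
  rw [superFactorial_mul_det_choose n fun i => r * (i : ℕ),
    ← det_vandermonde_id_eq_superFactorial (R := ℤ), ← Finset.prod_pow_eq_pow_sum, mul_comm,
    ← det_mul_row]
  congr 1
  ext i j
  simp [vandermonde_apply, mul_pow]

/-- For n ≥ 1 and r ≥ 2, the matrix B_{kN} = binom(rN, k) has nonzero determinant,
    but its determinant is neither 1 nor -1, so B is invertible over ℚ but not over ℤ. -/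
theorem pairing_matrix_det (n r : ℕ) (hn : 1 ≤ n) (hr : 2 ≤ r)
    (B : Matrix (Fin (n+1)) (Fin (n+1)) ℤ)
    (hB : ∀ k N : Fin (n+1), B k N = ((r * (N : ℕ)).choose (k : ℕ) : ℤ)) :
    B.det ≠ 0 ∧ B.det ≠ 1 ∧ B.det ≠ -1 := by
  have hdet : B.det = (r : ℤ) ^ ∑ j : Fin (n + 1), (j : ℕ) := by
    rw [← det_choose_mul, ← Matrix.det_transpose]
    congr 1
    ext i j
    exact hB j i
  have hsum : ∑ j : Fin (n + 1), (j : ℕ) ≠ 0 := by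
    have h := Finset.single_le_sum (f := fun j : Fin (n + 1) => (j : ℕ))
      (fun _ _ => Nat.zero_le _) (Finset.mem_univ (Fin.last n))
    simp only [Fin.val_last] at h
    omega
  have hlt : (1 : ℤ) < (r : ℤ) ^ ∑ j : Fin (n + 1), (j : ℕ) :=
    one_lt_pow₀ (by exact_mod_cast hr) hsum
  rw [hdet]
  refine ⟨?_, ?_, ?_⟩ <;> linarith
end

section
/- Fix an integer n ≥ 1 and take r = 2, so A(n,2) is the (n+1)×(n+1) integer matrix defined in the context. Then coker A(n,2) is isomorphic as an abelian group to ℤ × ℤ/2^nℤ, and the element e_1 of coker A(n,2) has additive order 2^n. -/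
/-- The (n+1)×(n+1) integer matrix A(n,r) with entries
    A_{ij} = (-1)^(i-j+1) * binom(r, i-j) for i > j and 0 otherwise. -/
def lensMatrix (n r : ℕ) : Matrix (Fin (n+1)) (Fin (n+1)) ℤ :=
  fun i j => if (j : ℕ) < (i : ℕ)
    then (-1 : ℤ) ^ ((i : ℕ) - (j : ℕ) + 1) * (r.choose ((i : ℕ) - (j : ℕ)) : ℤ)
    else 0

/-- The cokernel ℤ^(n+1) / Im A(n,r). -/
abbrev lensCoker (n r : ℕ) : Type :=
  (Fin (n+1) → ℤ) ⧸ LinearMap.range (Matrix.toLin' (lensMatrix n r))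

/-- The image e_j in the cokernel of the j-th standard basis vector of ℤ^(n+1). -/
def lensE (n r : ℕ) (j : Fin (n+1)) : lensCoker n r :=
  Submodule.Quotient.mk (Pi.single j 1)

/-- The `k`-th standard basis vector of `ℤ^(n+1)`, read as `0` when `k > n`. -/
def stdVec (n k : ℕ) : Fin (n + 1) → ℤ := fun i => if (i : ℕ) = k then 1 else 0

theorem stdVec_val (n : ℕ) (i : Fin (n + 1)) : stdVec n i = Pi.single i 1 := by
  ext j
  simp [stdVec, Pi.single_apply, Fin.ext_iff]

theorem stdVec_of_lt {n k : ℕ} (h : n < k) : stdVec n k = 0 := by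
  ext i
  have := i.isLt
  simp only [stdVec, Pi.zero_apply, ite_eq_right_iff]
  omega

theorem toLin'_lensMatrix_two_single (n : ℕ) (j : Fin (n + 1)) :
    Matrix.toLin' (lensMatrix n 2) (Pi.single j 1) =
      (2 : ℤ) • stdVec n (j + 1) - stdVec n (j + 2) := by
  ext i
  simp only [Matrix.toLin'_apply, Matrix.mulVec_single_one, Matrix.col_apply, lensMatrix, stdVec,
    Pi.sub_apply, Pi.smul_apply, smul_eq_mul]
  rcases lt_or_ge (j : ℕ) (i : ℕ) with h | h
  · obtain ⟨d, hd⟩ := Nat.exists_eq_add_of_lt h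
    rw [if_pos h, hd, show (j : ℕ) + d + 1 - j = d + 1 by omega]
    rcases d with _ | _ | d
    · simp
    · simp
    · rw [Nat.choose_eq_zero_of_lt (by omega), if_neg (by omega), if_neg (by omega)]
      simp
  · rw [if_neg (by omega), if_neg (by omega), if_neg (by omega)]
    simp

/-- The map `ℤ^(n+1) → ℤ × ℤ/2^n`, `v ↦ (v₀, ∑ i, 2^i v_{i+1})`. -/
def lensMap (n : ℕ) : (Fin (n + 1) → ℤ) →ₗ[ℤ] ℤ × ZMod (2 ^ n) :=
  (LinearMap.proj 0).prod
    (∑ i : Fin n, (LinearMap.proj i.succ).smulRight ((2 : ZMod (2 ^ n)) ^ (i : ℕ)))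

theorem lensMap_apply (n : ℕ) (v : Fin (n + 1) → ℤ) :
    lensMap n v = (v 0, ((∑ i : Fin n, v i.succ * 2 ^ (i : ℕ) : ℤ) : ZMod (2 ^ n))) := by
  simp [lensMap]

theorem lensMap_stdVec_succ (n k : ℕ) : lensMap n (stdVec n (k + 1)) = (0, 2 ^ k) := by
  rcases lt_or_ge k n with h | h
  · rw [lensMap_apply, Finset.sum_eq_single (⟨k, h⟩ : Fin n)]
    · simp [stdVec]
    · intro i _ hi
      have : (i : ℕ) ≠ k := fun e => hi (Fin.ext e)
      simp [stdVec, this]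
    · simp
  · have : (2 : ZMod (2 ^ n)) ^ n = 0 := by exact_mod_cast ZMod.natCast_self (2 ^ n)
    rw [stdVec_of_lt (by omega), map_zero, pow_eq_zero_of_le h this]
    rfl

theorem lensMap_surjective (n : ℕ) : Function.Surjective (lensMap n) := by
  rintro ⟨a, b⟩
  obtain ⟨c, rfl⟩ := ZMod.intCast_surjective b
  have h0 : lensMap n (stdVec n 0) = (1, 0) := by simp [lensMap_apply, stdVec]
  refine ⟨a • stdVec n 0 + c • stdVec n 1, ?_⟩
  rw [map_add, map_smul, map_smul, h0, lensMap_stdVec_succ n 0]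
  simp

theorem lensCoker_two_mk_stdVec_succ (n k : ℕ) (hk : k ≤ n + 1) :
    (Submodule.Quotient.mk (stdVec n (k + 1)) : lensCoker n 2) =
      (2 : ℤ) ^ k • Submodule.Quotient.mk (stdVec n 1) := by
  induction k with
  | zero => simp
  | succ k ih =>
    rw [pow_succ', mul_smul, ← ih (by omega), ← Submodule.Quotient.mk_smul, eq_comm,
      Submodule.Quotient.eq]
    exact ⟨Pi.single ⟨k, by omega⟩ 1, toLin'_lensMatrix_two_single n ⟨k, by omega⟩⟩

theorem lensCoker_two_mk_eq (n : ℕ) (v : Fin (n + 1) → ℤ) :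
    (Submodule.Quotient.mk v : lensCoker n 2) =
      v 0 • Submodule.Quotient.mk (stdVec n 0) +
        (∑ i : Fin n, v i.succ * 2 ^ (i : ℕ)) • Submodule.Quotient.mk (stdVec n 1) := by
  have hv : v = ∑ i : Fin (n + 1), v i • stdVec n i := by
    simp only [stdVec_val]
    simpa [Pi.single_apply] using pi_eq_sum_univ' v
  conv_lhs => rw [hv, ← Submodule.mkQ_apply, map_sum, Fin.sum_univ_succ]
  rw [Finset.sum_smul]
  congr 1
  refine Finset.sum_congr rfl fun i _ => ?_
  rw [map_smul, Submodule.mkQ_apply, Fin.val_succ,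
    lensCoker_two_mk_stdVec_succ n i (by omega), mul_smul]

theorem ker_lensMap (n : ℕ) :
    LinearMap.ker (lensMap n) = LinearMap.range (Matrix.toLin' (lensMatrix n 2)) := by
  apply le_antisymm
  · intro v hv
    rw [LinearMap.mem_ker, lensMap_apply, Prod.mk_eq_zero, ZMod.intCast_zmod_eq_zero_iff_dvd] at hv
    obtain ⟨h0, c, hc⟩ := hv
    have h := lensCoker_two_mk_stdVec_succ n n (by omega)
    rw [stdVec_of_lt (by omega), Submodule.Quotient.mk_zero] at h
    rw [← Submodule.Quotient.mk_eq_zero, lensCoker_two_mk_eq, h0, hc, mul_comm, mul_smul]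
    push_cast
    rw [← h]
    simp
  · rw [LinearMap.range_le_ker_iff]
    refine LinearMap.pi_ext' fun j => LinearMap.ext_ring ?_
    simp only [LinearMap.comp_apply, LinearMap.single_apply, LinearMap.zero_apply]
    rw [toLin'_lensMatrix_two_single, map_sub, map_smul, lensMap_stdVec_succ,
      lensMap_stdVec_succ n (j + 1)]
    simp [pow_succ']

/-- The isomorphism `coker A(n,2) ≃ ℤ × ℤ/2^n` induced by `lensMap`. -/
noncomputable def lensCokerTwoEquiv (n : ℕ) :
    lensCoker n 2 ≃ₗ[ℤ] ℤ × ZMod (2 ^ n) :=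
  (Submodule.quotEquivOfEq _ _ (ker_lensMap n).symm).trans
    ((lensMap n).quotKerEquivOfSurjective (lensMap_surjective n))

/-- For n ≥ 1 and r = 2, coker A(n,2) ≅ ℤ × ℤ/2^n and e₁ has additive order 2^n. -/
theorem lens_coker_r_two (n : ℕ) (hn : 1 ≤ n) :
    Nonempty (lensCoker n 2 ≃+ ℤ × ZMod (2 ^ n)) ∧
    addOrderOf (lensE n 2 ⟨1, by omega⟩) = 2 ^ n := by
  refine ⟨⟨(lensCokerTwoEquiv n).toAddEquiv⟩, ?_⟩
  rw [← AddEquiv.addOrderOf_eq (lensCokerTwoEquiv n).toAddEquiv, lensE, ← stdVec_val]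
  change addOrderOf (lensMap n (stdVec n (0 + 1))) = 2 ^ n
  rw [lensMap_stdVec_succ, pow_zero, Prod.addOrderOf, addOrderOf_zero, ZMod.addOrderOf_one,
    Nat.lcm_one_left]
end

section
/- Fix an even integer r ≥ 2 and take n = 2, so A(2,r) is the 3×3 integer matrix defined in the context. Then coker A(2,r) is isomorphic as an abelian group to ℤ × ℤ/(r/2)ℤ × ℤ/(2r)ℤ; moreover, in coker A(2,r) the element e_2 + 2·e_1 has additive order r/2 and the element e_1 has additive order 2r. -/
open Matrix

theorem lensMatrix_two_two_mul (s : ℕ) :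
    lensMatrix 2 (2 * s) =
      !![0, 0, 0; 2 * (s : ℤ), 0, 0; -((s : ℤ) * (2 * s - 1)), 2 * (s : ℤ), 0] := by
  have h : (((2 * s).choose 2 : ℕ) : ℤ) = (s : ℤ) * (2 * s - 1) := by
    have h1 : (2 * s).choose 2 = s * (2 * s - 1) := by
      rw [Nat.choose_two_right, mul_assoc, Nat.mul_div_cancel_left _ two_pos]
    rcases Nat.eq_zero_or_pos s with rfl | hs
    · simp
    · rw [h1]
      push_cast [Nat.cast_sub (show 1 ≤ 2 * s by omega)]
      ring
  ext i j
  fin_cases i <;> fin_cases j <;> simp [lensMatrix, h]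

theorem toLin'_lensMatrix_two_two_mul_apply (s : ℕ) (y : Fin 3 → ℤ) :
    toLin' (lensMatrix 2 (2 * s)) y =
      ![0, 2 * s * y 0, -((s : ℤ) * (2 * s - 1)) * y 0 + 2 * s * y 1] := by
  rw [lensMatrix_two_two_mul, toLin'_apply]
  ext i
  rw [mulVec, dotProduct]
  refine (Fin.sum_univ_three _).trans ?_
  fin_cases i <;> simp

theorem mem_range_lensMatrix_two_two_mul (s : ℕ) (x : Fin 3 → ℤ) :
    x ∈ LinearMap.range (toLin' (lensMatrix 2 (2 * s))) ↔
      x 0 = 0 ∧ (s : ℤ) ∣ x 2 ∧ (4 * s : ℤ) ∣ x 1 - 2 * x 2 := by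
  constructor
  · rintro ⟨y, rfl⟩
    rw [toLin'_lensMatrix_two_two_mul_apply]
    simp only [cons_val]
    exact ⟨trivial, ⟨-(2 * s - 1) * y 0 + 2 * y 1, by ring⟩, ⟨s * y 0 - y 1, by ring⟩⟩
  · rintro ⟨h0, ⟨c, hc⟩, ⟨d, hd⟩⟩
    refine ⟨![c + 2 * d, s * c + (2 * s - 1) * d, 0], ?_⟩
    rw [toLin'_lensMatrix_two_two_mul_apply]
    ext i
    fin_cases i <;> simp only [cons_val, Fin.zero_eta, Fin.mk_one, Fin.reduceFinMk]
    · exact h0.symm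
    · linear_combination -hd - 2 * hc
    · linear_combination -hc

/-- Coordinates on `ℤ³` adapted to the basis `e₀, e₂ + 2e₁, e₁`, the last two reduced
modulo `s` and `4s`. -/
def lensTwoEvenHom (s : ℕ) : (Fin 3 → ℤ) →ₗ[ℤ] ℤ × ZMod s × ZMod (2 * (2 * s)) :=
  AddMonoidHom.toIntLinearMap
    { toFun := fun x => (x 0, ((x 2 : ℤ) : ZMod s), ((x 1 - 2 * x 2 : ℤ) : ZMod (2 * (2 * s))))
      map_zero' := by simp
      map_add' := fun x y => by
        ext
        · simp
        · simp
        · simp only [Pi.add_apply, Prod.snd_add]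
          push_cast
          ring }

theorem lensTwoEvenHom_apply (s : ℕ) (x : Fin 3 → ℤ) :
    lensTwoEvenHom s x =
      (x 0, ((x 2 : ℤ) : ZMod s), ((x 1 - 2 * x 2 : ℤ) : ZMod (2 * (2 * s)))) :=
  rfl

theorem lensTwoEvenHom_surjective (s : ℕ) : Function.Surjective (lensTwoEvenHom s) := by
  rintro ⟨a, b, c⟩
  obtain ⟨b, rfl⟩ := ZMod.intCast_surjective b
  obtain ⟨c, rfl⟩ := ZMod.intCast_surjective c
  exact ⟨![a, c + 2 * b, b], by simp [lensTwoEvenHom_apply]⟩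

theorem range_lensMatrix_eq_ker_lensTwoEvenHom (s : ℕ) :
    LinearMap.range (toLin' (lensMatrix 2 (2 * s))) = LinearMap.ker (lensTwoEvenHom s) := by
  ext x
  rw [mem_range_lensMatrix_two_two_mul, LinearMap.mem_ker, lensTwoEvenHom_apply,
    Prod.mk_eq_zero, Prod.mk_eq_zero, CharP.intCast_eq_zero_iff (ZMod s) s,
    CharP.intCast_eq_zero_iff (ZMod (2 * (2 * s))) (2 * (2 * s))]
  push_cast
  rw [show (2 * (2 * s) : ℤ) = 4 * s by ring]

/-- The isomorphism from the cokernel of `A(2, 2s)` induced by `lensTwoEvenHom`. -/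
noncomputable def lensCokerTwoEvenEquiv (s : ℕ) :
    lensCoker 2 (2 * s) ≃ₗ[ℤ] ℤ × ZMod s × ZMod (2 * (2 * s)) :=
  (Submodule.quotEquivOfEq _ _ (range_lensMatrix_eq_ker_lensTwoEvenHom s)).trans
    ((lensTwoEvenHom s).quotKerEquivOfSurjective (lensTwoEvenHom_surjective s))

theorem lensCokerTwoEvenEquiv_lensE (s : ℕ) (j : Fin 3) :
    lensCokerTwoEvenEquiv s (lensE 2 (2 * s) j) = lensTwoEvenHom s (Pi.single j 1) :=
  rfl

/-- For n = 2 and even r ≥ 2, coker A(2,r) ≅ ℤ × ℤ/(r/2) × ℤ/(2r);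
    e₂ + 2e₁ has order r/2 and e₁ has order 2r. -/
theorem lens_coker_n_two_even (r : ℕ) (hr : 2 ≤ r) (h2 : 2 ∣ r) :
    Nonempty (lensCoker 2 r ≃+ ℤ × ZMod (r / 2) × ZMod (2 * r)) ∧
    addOrderOf (lensE 2 r 2 + 2 • lensE 2 r 1) = r / 2 ∧
    addOrderOf (lensE 2 r 1) = 2 * r := by
  obtain ⟨s, rfl⟩ := h2
  rw [Nat.mul_div_cancel_left s two_pos]
  refine ⟨⟨(lensCokerTwoEvenEquiv s).toAddEquiv⟩, ?_, ?_⟩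
  · rw [← (lensCokerTwoEvenEquiv s).toAddEquiv.addOrderOf_eq]
    have h : (lensCokerTwoEvenEquiv s).toAddEquiv (lensE 2 (2 * s) 2 + 2 • lensE 2 (2 * s) 1) =
        (0, 1, 0) := by
      rw [map_add, map_nsmul]
      simp [lensCokerTwoEvenEquiv_lensE, lensTwoEvenHom_apply]
    simp [h, Prod.addOrderOf, ZMod.addOrderOf_one]
  · rw [← (lensCokerTwoEvenEquiv s).toAddEquiv.addOrderOf_eq]
    have h : (lensCokerTwoEvenEquiv s).toAddEquiv (lensE 2 (2 * s) 1) = (0, 0, 1) := by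
      simp [lensCokerTwoEvenEquiv_lensE, lensTwoEvenHom_apply]
    simp [h, Prod.addOrderOf, ZMod.addOrderOf_one]
end

section
/- Fix an integer r ≥ 3 that is odd and divisible by 3 (i.e. r ≡ 3 mod 6), and take n = 3, so A(3,r) is the 4×4 integer matrix defined in the context. Then coker A(3,r) is isomorphic as an abelian group to ℤ × ℤ/(r/3)ℤ × ℤ/rℤ × ℤ/(3r)ℤ; moreover, in coker A(3,r) the element e_3 + 3·e_1 has additive order r/3, the element e_2 has additive order r, and the element e_1 has additive order 3r. -/
theorem choose_two_six_mul_add_three (k : ℕ) :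
    (6 * k + 3).choose 2 = (6 * k + 3) * (3 * k + 1) := by
  have h := Nat.choose_succ_right_eq (6 * k + 3) 1
  rw [Nat.choose_one_right, show 6 * k + 3 - 1 = 2 * (3 * k + 1) by omega] at h
  linarith

theorem choose_three_six_mul_add_three (k : ℕ) :
    (6 * k + 3).choose 3 = (2 * k + 1) * (3 * k + 1) * (6 * k + 1) := by
  have h := Nat.choose_succ_right_eq (6 * k + 3) 2
  rw [choose_two_six_mul_add_three, show 6 * k + 3 - 2 = 6 * k + 1 by omega] at h
  linarith

/-- The projection `v ↦ (v₀, v₃, v₂, v₁ - 3 v₃)`, whose kernel is the image of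
`lensMatrix 3 (6 * k + 3)`. -/
def lensProj (k : ℕ) : (Fin 4 → ℤ) →ₗ[ℤ]
    ℤ × ZMod (2 * k + 1) × ZMod (6 * k + 3) × ZMod (3 * (6 * k + 3)) :=
  AddMonoidHom.toIntLinearMap
    { toFun := fun v => (v 0, (v 3 : ℤ), (v 2 : ℤ), ((v 1 - 3 * v 3 : ℤ)))
      map_zero' := by simp
      map_add' := fun v w => by
        ext <;> simp
        ring }

theorem lensProj_apply (k : ℕ) (v : Fin 4 → ℤ) :
    lensProj k v = (v 0, ((v 3 : ℤ) : ZMod (2 * k + 1)), ((v 2 : ℤ) : ZMod (6 * k + 3)),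
      ((v 1 - 3 * v 3 : ℤ) : ZMod (3 * (6 * k + 3)))) := rfl

theorem lensProj_eq_zero_iff (k : ℕ) (v : Fin 4 → ℤ) :
    lensProj k v = 0 ↔ v 0 = 0 ∧ (2 * k + 1 : ℤ) ∣ v 3 ∧ (6 * k + 3 : ℤ) ∣ v 2 ∧
      (3 * (6 * k + 3) : ℤ) ∣ v 1 - 3 * v 3 := by
  rw [lensProj_apply]
  simp only [Prod.mk_eq_zero, ZMod.intCast_zmod_eq_zero_iff_dvd]
  push_cast
  rfl

theorem lensProj_surjective (k : ℕ) : Function.Surjective (lensProj k) := by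
  rintro ⟨a, b, c, d⟩
  obtain ⟨b, rfl⟩ := ZMod.intCast_surjective b
  obtain ⟨c, rfl⟩ := ZMod.intCast_surjective c
  obtain ⟨d, rfl⟩ := ZMod.intCast_surjective d
  exact ⟨![a, d + 3 * b, c, b], by simp [lensProj_apply]⟩

theorem lensMatrix_three_mulVec (k : ℕ) (w : Fin 4 → ℤ) :
    Matrix.toLin' (lensMatrix 3 (6 * k + 3)) w =
      ![0, (6 * k + 3) * w 0,
        -((6 * k + 3) * (3 * k + 1)) * w 0 + (6 * k + 3) * w 1,
        (2 * k + 1) * (3 * k + 1) * (6 * k + 1) * w 0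
          - (6 * k + 3) * (3 * k + 1) * w 1 + (6 * k + 3) * w 2] := by
  ext i
  fin_cases i <;>
    simp [Matrix.mulVec, dotProduct, Fin.sum_univ_four, lensMatrix,
      choose_two_six_mul_add_three, choose_three_six_mul_add_three]
  ring

theorem range_lensMatrix_three (k : ℕ) :
    LinearMap.range (Matrix.toLin' (lensMatrix 3 (6 * k + 3))) = LinearMap.ker (lensProj k) := by
  ext v
  refine Iff.trans ?_ (lensProj_eq_zero_iff k v).symm
  rw [LinearMap.mem_range]
  constructor
  · rintro ⟨w, rfl⟩
    rw [lensMatrix_three_mulVec]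
    refine ⟨rfl, ?_, ?_, ?_⟩ <;> simp only [Matrix.cons_val]
    · exact ⟨(3 * k + 1) * (6 * k + 1) * w 0 - 3 * (3 * k + 1) * w 1 + 3 * w 2, by ring⟩
    · exact ⟨-(3 * k + 1) * w 0 + w 1, by ring⟩
    · exact ⟨-(3 * k * (2 * k + 1)) * w 0 + (3 * k + 1) * w 1 - w 2, by ring⟩
  · rintro ⟨h0, ⟨a, ha⟩, ⟨b, hb⟩, ⟨c, hc⟩⟩
    refine ⟨![a + 3 * c, b + (3 * k + 1) * (a + 3 * c),
      -(3 * k * (2 * k + 1)) * a - (3 * k + 1) * (6 * k + 1) * c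
        + (3 * k + 1) * (b + (3 * k + 1) * (a + 3 * c)), 0], ?_⟩
    rw [lensMatrix_three_mulVec]
    ext i
    fin_cases i <;> simp only [Matrix.cons_val, Fin.mk_one, Fin.zero_eta, Fin.reduceFinMk]
    · exact h0.symm
    · linear_combination -hc - 3 * ha
    · linear_combination -hb
    · linear_combination -ha

/-- The isomorphism from the cokernel induced by `lensProj`. -/
noncomputable def lensCokerEquiv (k : ℕ) : lensCoker 3 (6 * k + 3) ≃ₗ[ℤ]
    ℤ × ZMod (2 * k + 1) × ZMod (6 * k + 3) × ZMod (3 * (6 * k + 3)) :=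
  (Submodule.quotEquivOfEq _ _ (range_lensMatrix_three k)).trans
    ((lensProj k).quotKerEquivOfSurjective (lensProj_surjective k))

theorem lensCokerEquiv_mk (k : ℕ) (v : Fin 4 → ℤ) :
    lensCokerEquiv k (Submodule.Quotient.mk v) = lensProj k v := rfl

/-- For n = 3 and odd r ≥ 3 divisible by 3,
    coker A(3,r) ≅ ℤ × ℤ/(r/3) × ℤ/r × ℤ/(3r), with
    e₃ + 3e₁ of order r/3, e₂ of order r and e₁ of order 3r. -/
theorem lens_coker_n_three_odd_three_dvd (r : ℕ) (hr : 3 ≤ r)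
    (hodd : Odd r) (h3 : 3 ∣ r) :
    Nonempty (lensCoker 3 r ≃+ ℤ × ZMod (r / 3) × ZMod r × ZMod (3 * r)) ∧
    addOrderOf (lensE 3 r 3 + 3 • lensE 3 r 1) = r / 3 ∧
    addOrderOf (lensE 3 r 2) = r ∧
    addOrderOf (lensE 3 r 1) = 3 * r := by
  obtain ⟨k, rfl⟩ : ∃ k, r = 6 * k + 3 := by
    obtain ⟨a, ha⟩ := hodd
    exact ⟨r / 6, by omega⟩
  have hdiv : (6 * k + 3) / 3 = 2 * k + 1 := by omega
  rw [hdiv]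
  have hE (j : Fin 4) : lensCokerEquiv k (lensE 3 (6 * k + 3) j) =
      lensProj k (Pi.single j 1) := lensCokerEquiv_mk k _
  refine ⟨⟨(lensCokerEquiv k).toAddEquiv⟩, ?_, ?_, ?_⟩
  · rw [← addOrderOf_injective (lensCokerEquiv k).toAddEquiv.toAddMonoidHom
      (lensCokerEquiv k).injective]
    have h : lensCokerEquiv k (lensE 3 (6 * k + 3) 3 + 3 • lensE 3 (6 * k + 3) 1) =
        (0, 1, 0, 0) := by
      rw [map_add, map_nsmul, hE, hE]
      simp [lensProj_apply]
    exact (congrArg addOrderOf h).trans (by simp [Prod.addOrderOf, ZMod.addOrderOf_one])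
  · rw [← addOrderOf_injective (lensCokerEquiv k).toAddEquiv.toAddMonoidHom
      (lensCokerEquiv k).injective]
    have h : lensCokerEquiv k (lensE 3 (6 * k + 3) 2) = (0, 0, 1, 0) := by
      rw [hE]
      simp [lensProj_apply]
    exact (congrArg addOrderOf h).trans (by simp [Prod.addOrderOf, ZMod.addOrderOf_one])
  · rw [← addOrderOf_injective (lensCokerEquiv k).toAddEquiv.toAddMonoidHom
      (lensCokerEquiv k).injective]
    have h : lensCokerEquiv k (lensE 3 (6 * k + 3) 1) = (0, 0, 0, 1) := by
      rw [hE]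
      simp [lensProj_apply]
    exact (congrArg addOrderOf h).trans (by simp [Prod.addOrderOf, ZMod.addOrderOf_one])
end

section
/- Fix an integer r divisible by 2 but not by 3 and not by 4 (i.e. r ≡ 2 or 10 mod 12), and take n = 4, so A(4,r) is the 5×5 integer matrix defined in the context. Then coker A(4,r) is isomorphic as an abelian group to ℤ × ℤ/(r/2)ℤ × ℤ/(r/2)ℤ × ℤ/(r/2)ℤ × ℤ/(8r)ℤ. -/
/-- For `p` with `3 ∤ 2p + 1`, the entries of `A(4, 4p + 2)` are `2p + 1` times explicit integers. -/
lemma choose_four_mul_add_two (p : ℕ) (h3 : ¬ 3 ∣ 2 * p + 1) :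
    ∃ v w : ℤ, ((4 * p + 2).choose 2 : ℤ) = (2 * p + 1) * (4 * p + 1) ∧
      ((4 * p + 2).choose 3 : ℤ) = (2 * p + 1) * (4 * v) ∧
      ((4 * p + 2).choose 4 : ℤ) = (2 * p + 1) * w := by
  obtain ⟨v, hv⟩ : 3 ∣ p * (4 * p + 1) := by
    have : p % 3 = 0 ∨ p % 3 = 2 := by omega
    rcases this with h | h
    · exact Dvd.dvd.mul_right (by omega) _
    · exact Dvd.dvd.mul_left (by omega) _
  have e2 := Nat.choose_succ_right_eq (4 * p + 2) 1
  have e3 := Nat.choose_succ_right_eq (4 * p + 2) 2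
  have e4 := Nat.choose_succ_right_eq (4 * p + 2) 3
  rw [Nat.choose_one_right, show 4 * p + 2 - 1 = 4 * p + 1 by omega] at e2
  rw [show 4 * p + 2 - 2 = 4 * p by omega] at e3
  zify at hv e2 e3
  norm_num at e2 e3
  have c2 : ((4 * p + 2).choose 2 : ℤ) = (2 * p + 1) * (4 * p + 1) := by linarith
  have c3 : ((4 * p + 2).choose 3 : ℤ) = (2 * p + 1) * (4 * v) := by
    rw [c2] at e3
    linarith [congrArg (fun z : ℤ => (2 * p + 1) * z) hv]
  refine ⟨v, v * (4 * p - 1), c2, c3, ?_⟩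
  rcases p with _ | p
  · have : v = 0 := by simpa using hv.symm
    simp [this, Nat.choose_eq_zero_of_lt]
  · rw [show 4 * (p + 1) + 2 - 3 = 4 * p + 3 by omega] at e4
    zify at e4
    rw [c3] at e4
    push_cast at e4 ⊢
    linarith

/-- The lower triangular Toeplitz matrix with first column `(2, -(4p + 1), 4v, -w)` maps `ℤ⁴` onto
the kernel of an explicit surjection to `ℤ/16`. -/
lemma exists_toeplitz_preimage_iff (p v w z₁ z₂ z₃ z₄ : ℤ) :
    (∃ y₁ y₂ y₃ y₄ : ℤ, z₁ = 2 * y₁ ∧ z₂ = -(4 * p + 1) * y₁ + 2 * y₂ ∧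
      z₃ = 4 * v * y₁ - (4 * p + 1) * y₂ + 2 * y₃ ∧
      z₄ = -w * y₁ + 4 * v * y₂ - (4 * p + 1) * y₃ + 2 * y₄) ↔
    16 ∣ z₁ + (2 + 8 * (p + w)) * z₂ + 4 * z₃ + 8 * z₄ := by
  constructor
  · rintro ⟨y₁, y₂, y₃, y₄, rfl, rfl, rfl, rfl⟩
    refine ⟨(-p - 2 * p * (p + w) - w + v) * y₁ + (w + 2 * v) * y₂ - 2 * p * y₃ + y₄, ?_⟩
    ring
  · rintro ⟨n, hn⟩
    obtain rfl : z₁ = 16 * n - (2 + 8 * (p + w)) * z₂ - 4 * z₃ - 8 * z₄ := by linarith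
    set y₁ := 8 * n - (1 + 4 * (p + w)) * z₂ - 2 * z₃ - 4 * z₄ with h₁
    set y₂ := (4 * p + 1) * (4 * n - z₃ - 2 * z₄)
      - 2 * (p + (p + w) + 4 * p * (p + w)) * z₂ with h₂
    set y₃ := (4 * p + 1) ^ 2 * (2 * n - z₄) - (4 * p + 8 * p ^ 2) * z₃
      - (4 * p + 1) * (p + (p + w) + 4 * p * (p + w)) * z₂ - 2 * v * y₁ with h₃
    refine ⟨y₁, y₂, y₃, (4 * p + 1) ^ 3 * n - (6 * p + 24 * p ^ 2 + 32 * p ^ 3) * z₄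
      - (4 * p + 1) * (2 * p + 4 * p ^ 2) * z₃
      - (p + w + 2 * p * (p + w)
        + (4 * p + 8 * p ^ 2) * (p + (p + w) + 4 * p * (p + w)) + 2 * w * (p + w)) * z₂
      - (4 * p + 1) * v * y₁ - 2 * v * y₂ + w * (4 * n - z₃ - 2 * z₄), ?_, ?_, ?_, ?_⟩
    · rw [h₁]; ring
    · rw [h₂, h₁]; ring
    · rw [h₃, h₂, h₁]; ring
    · rw [h₃, h₂, h₁]; ring

/-- The map `ℤ⁵ → ℤ × (ℤ/m)³ × ℤ/16m` whose last component is `x₁ + b x₂ + 4 x₃ + 8 x₄`. -/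
def lensFourMap (m : ℕ) (b : ℤ) :
    (Fin 5 → ℤ) →+ ℤ × ZMod m × ZMod m × ZMod m × ZMod (16 * m) where
  toFun x := (x 0, (x 2 : ℤ), (x 3 : ℤ), (x 4 : ℤ), ((x 1 + b * x 2 + 4 * x 3 + 8 * x 4 : ℤ)))
  map_zero' := by simp
  map_add' x y := by
    simp only [Pi.add_apply, Prod.mk_add_mk, Prod.mk.injEq]
    push_cast
    refine ⟨trivial, rfl, rfl, rfl, ?_⟩
    ring

lemma lensFourMap_surjective (m : ℕ) (b : ℤ) : Function.Surjective (lensFourMap m b) := by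
  rintro ⟨a, c, d, e, f⟩
  obtain ⟨c, rfl⟩ := ZMod.intCast_surjective c
  obtain ⟨d, rfl⟩ := ZMod.intCast_surjective d
  obtain ⟨e, rfl⟩ := ZMod.intCast_surjective e
  obtain ⟨f, rfl⟩ := ZMod.intCast_surjective f
  exact ⟨![a, f - b * c - 4 * d - 8 * e, c, d, e], by simp [lensFourMap]; ring⟩

lemma lensFourMap_eq_zero_iff (m : ℕ) (b : ℤ) (x : Fin 5 → ℤ) :
    lensFourMap m b x = 0 ↔ x 0 = 0 ∧ (m : ℤ) ∣ x 2 ∧ (m : ℤ) ∣ x 3 ∧ (m : ℤ) ∣ x 4 ∧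
      (16 * m : ℤ) ∣ x 1 + b * x 2 + 4 * x 3 + 8 * x 4 := by
  simp only [lensFourMap, AddMonoidHom.coe_mk, ZeroHom.coe_mk, Prod.mk_eq_zero]
  simp only [ZMod.intCast_zmod_eq_zero_iff_dvd]
  push_cast
  rfl

lemma mem_range_lensMatrix_four_iff (r : ℕ) (x : Fin 5 → ℤ) :
    x ∈ LinearMap.range (Matrix.toLin' (lensMatrix 4 r)) ↔
      ∃ y₁ y₂ y₃ y₄ : ℤ, x 0 = 0 ∧ x 1 = r * y₁ ∧ x 2 = -(r.choose 2) * y₁ + r * y₂ ∧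
        x 3 = r.choose 3 * y₁ - r.choose 2 * y₂ + r * y₃ ∧
        x 4 = -(r.choose 4) * y₁ + r.choose 3 * y₂ - r.choose 2 * y₃ + r * y₄ := by
  have key (y : Fin 5 → ℤ) : Matrix.toLin' (lensMatrix 4 r) y = x ↔
      x 0 = 0 ∧ x 1 = r * y 0 ∧ x 2 = -(r.choose 2) * y 0 + r * y 1 ∧
        x 3 = r.choose 3 * y 0 - r.choose 2 * y 1 + r * y 2 ∧
        x 4 = -(r.choose 4) * y 0 + r.choose 3 * y 1 - r.choose 2 * y 2 + r * y 3 := by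
    rw [eq_comm, funext_iff]
    simp [Fin.forall_fin_succ, Matrix.mulVec, dotProduct, Fin.sum_univ_succ, lensMatrix]
    norm_num [Fin.ext_iff, ← add_assoc, ← sub_eq_add_neg]
    simp [← add_sub_assoc]
  constructor
  · rintro ⟨y, hy⟩
    exact ⟨y 0, y 1, y 2, y 3, (key y).1 hy⟩
  · rintro ⟨y₁, y₂, y₃, y₄, h⟩
    exact ⟨![y₁, y₂, y₃, y₄, 0], (key ![y₁, y₂, y₃, y₄, 0]).2 (by simpa using h)⟩

/-- For n = 4 and r divisible by 2 but not by 3 nor by 4,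
    coker A(4,r) ≅ ℤ × ℤ/(r/2) × ℤ/(r/2) × ℤ/(r/2) × ℤ/(8r). -/
theorem lens_coker_n_four_2_not_3_not_4 (r : ℕ) (h2 : 2 ∣ r)
    (h3 : ¬ (3 ∣ r)) (h4 : ¬ (4 ∣ r)) :
    Nonempty (lensCoker 4 r ≃+
      ℤ × ZMod (r / 2) × ZMod (r / 2) × ZMod (r / 2) × ZMod (8 * r)) := by
  obtain ⟨p, rfl⟩ : ∃ p, r = 4 * p + 2 := ⟨r / 4, by omega⟩
  obtain ⟨v, w, c2, c3, c4⟩ := choose_four_mul_add_two p (by omega)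
  rw [show (4 * p + 2) / 2 = 2 * p + 1 by omega, show 8 * (4 * p + 2) = 16 * (2 * p + 1) by ring]
  set φ := lensFourMap (2 * p + 1) (2 + 8 * (p + w)) with hφ
  have hm : (2 * p + 1 : ℤ) ≠ 0 := by omega
  have hker : (LinearMap.range (Matrix.toLin' (lensMatrix 4 (4 * p + 2)))).toAddSubgroup
      = φ.ker := by
    ext x
    rw [Submodule.mem_toAddSubgroup, mem_range_lensMatrix_four_iff, AddMonoidHom.mem_ker, hφ,
      lensFourMap_eq_zero_iff, c2, c3, c4]
    push_cast
    constructor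
    · rintro ⟨y₁, y₂, y₃, y₄, h₀, h₁, h₂, h₃, h₄⟩
      obtain ⟨n, hn⟩ := (exists_toeplitz_preimage_iff p v w _ _ _ _).1
        ⟨y₁, y₂, y₃, y₄, rfl, rfl, rfl, rfl⟩
      refine ⟨h₀, ⟨-(4 * p + 1) * y₁ + 2 * y₂, ?_⟩,
        ⟨4 * v * y₁ - (4 * p + 1) * y₂ + 2 * y₃, ?_⟩,
        ⟨-w * y₁ + 4 * v * y₂ - (4 * p + 1) * y₃ + 2 * y₄, ?_⟩, ⟨n, ?_⟩⟩
      · rw [h₂]; ring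
      · rw [h₃]; ring
      · rw [h₄]; ring
      · rw [h₁, h₂, h₃, h₄]
        linear_combination (2 * p + 1 : ℤ) * hn
    · rintro ⟨h₀, ⟨z₂, h₂⟩, ⟨z₃, h₃⟩, ⟨z₄, h₄⟩, ⟨n, hn⟩⟩
      obtain ⟨y₁, y₂, y₃, y₄, e₁, e₂, e₃, e₄⟩ := (exists_toeplitz_preimage_iff p v w
        (16 * n - (2 + 8 * (p + w)) * z₂ - 4 * z₃ - 8 * z₄) z₂ z₃ z₄).2 ⟨n, by ring⟩
      refine ⟨y₁, y₂, y₃, y₄, h₀, ?_, ?_, ?_, ?_⟩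
      · rw [h₂, h₃, h₄] at hn
        linear_combination hn + (2 * p + 1 : ℤ) * e₁
      · linear_combination h₂ + (2 * p + 1 : ℤ) * e₂
      · linear_combination h₃ + (2 * p + 1 : ℤ) * e₃
      · linear_combination h₄ + (2 * p + 1 : ℤ) * e₄
  exact ⟨(QuotientAddGroup.quotientAddEquivOfEq hker).trans
    (QuotientAddGroup.quotientKerEquivOfSurjective φ (lensFourMap_surjective _ _))⟩
end

section
/- Fix an integer r ≥ 1 coprime to 6 (i.e. r ≡ 1 or 5 mod 6), and take n = 4, so A(4,r) is the 5×5 integer matrix defined in the context. Then coker A(4,r) is isomorphic as an abelian group to ℤ × ℤ/rℤ × ℤ/rℤ × ℤ/rℤ × ℤ/rℤ. -/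
/-- A positive `r` divides `r.choose k` whenever it is coprime to `k ≠ 0`. -/
theorem dvd_choose_of_coprime {r k : ℕ} (hr : r ≠ 0) (hk : k ≠ 0) (h : r.Coprime k) :
    r ∣ r.choose k := by
  obtain ⟨m, rfl⟩ := Nat.exists_eq_succ_of_ne_zero hr
  obtain ⟨l, rfl⟩ := Nat.exists_eq_succ_of_ne_zero hk
  exact h.dvd_of_dvd_mul_right ⟨m.choose l, (Nat.add_one_mul_choose_eq m l).symm⟩

/-- Keep the first coordinate and reduce the other four modulo `r`. -/
def reduceTail (r : ℕ) :
    (Fin 5 → ℤ) →ₗ[ℤ] ℤ × ZMod r × ZMod r × ZMod r × ZMod r :=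
  AddMonoidHom.toIntLinearMap
    { toFun := fun v => (v 0, (v 1 : ZMod r), (v 2 : ZMod r), (v 3 : ZMod r), (v 4 : ZMod r))
      map_zero' := by simp
      map_add' := by simp }

theorem reduceTail_apply (r : ℕ) (v : Fin 5 → ℤ) :
    reduceTail r v = (v 0, (v 1 : ZMod r), (v 2 : ZMod r), (v 3 : ZMod r), (v 4 : ZMod r)) :=
  rfl

theorem reduceTail_surjective (r : ℕ) : Function.Surjective (reduceTail r) := by
  rintro ⟨a, b, c, d, e⟩
  obtain ⟨b, rfl⟩ := ZMod.intCast_surjective b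
  obtain ⟨c, rfl⟩ := ZMod.intCast_surjective c
  obtain ⟨d, rfl⟩ := ZMod.intCast_surjective d
  obtain ⟨e, rfl⟩ := ZMod.intCast_surjective e
  exact ⟨![a, b, c, d, e], rfl⟩

theorem mem_ker_reduceTail (r : ℕ) (v : Fin 5 → ℤ) :
    v ∈ LinearMap.ker (reduceTail r) ↔
      v 0 = 0 ∧ (r : ℤ) ∣ v 1 ∧ (r : ℤ) ∣ v 2 ∧ (r : ℤ) ∣ v 3 ∧ (r : ℤ) ∣ v 4 := by
  simp [reduceTail_apply, ZMod.intCast_zmod_eq_zero_iff_dvd]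

theorem toLin'_lensMatrix_four_apply (r : ℕ) (x : Fin 5 → ℤ) :
    Matrix.toLin' (lensMatrix 4 r) x =
      ![0, r * x 0, -r.choose 2 * x 0 + r * x 1,
        r.choose 3 * x 0 - r.choose 2 * x 1 + r * x 2,
        -r.choose 4 * x 0 + r.choose 3 * x 1 - r.choose 2 * x 2 + r * x 3] := by
  ext i
  fin_cases i <;>
    simp [Matrix.mulVec, dotProduct, Fin.sum_univ_succ, lensMatrix] <;> ring

theorem range_lensMatrix_four {r : ℕ} (hr : r ≠ 0) (hcop : r.Coprime 6) :
    LinearMap.range (Matrix.toLin' (lensMatrix 4 r)) = LinearMap.ker (reduceTail r) := by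
  have h2 : r.Coprime 2 := hcop.coprime_dvd_right (by norm_num)
  have h3 : r.Coprime 3 := hcop.coprime_dvd_right (by norm_num)
  have h4 : r.Coprime 4 := h2.mul_right h2
  obtain ⟨c₂, h₂⟩ := dvd_choose_of_coprime hr two_ne_zero h2
  obtain ⟨c₃, h₃⟩ := dvd_choose_of_coprime hr three_ne_zero h3
  obtain ⟨c₄, h₄⟩ := dvd_choose_of_coprime hr four_ne_zero h4
  ext v
  rw [mem_ker_reduceTail, LinearMap.mem_range]
  simp only [toLin'_lensMatrix_four_apply, h₂, h₃, h₄, Nat.cast_mul]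
  constructor
  · rintro ⟨x, rfl⟩
    refine ⟨rfl, ⟨x 0, rfl⟩, ⟨-c₂ * x 0 + x 1, ?_⟩, ⟨c₃ * x 0 - c₂ * x 1 + x 2, ?_⟩,
      ⟨-c₄ * x 0 + c₃ * x 1 - c₂ * x 2 + x 3, ?_⟩⟩ <;> simp <;> ring
  · rintro ⟨h0, ⟨w₁, h1⟩, ⟨w₂, h2⟩, ⟨w₃, h3⟩, ⟨w₄, h4⟩⟩
    let x₁ : ℤ := w₂ + c₂ * w₁
    let x₂ : ℤ := w₃ + c₂ * x₁ - c₃ * w₁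
    let x₃ : ℤ := w₄ + c₂ * x₂ - c₃ * x₁ + c₄ * w₁
    refine ⟨![w₁, x₁, x₂, x₃, 0], ?_⟩
    ext i
    fin_cases i <;> simp [h0, h1, h2, h3, h4, x₁, x₂, x₃] <;> ring

/-- For n = 4 and r ≥ 1 coprime to 6,
    coker A(4,r) ≅ ℤ × ℤ/r × ℤ/r × ℤ/r × ℤ/r. -/
theorem lens_coker_n_four_coprime_six (r : ℕ) (hr : 1 ≤ r)
    (hcop : Nat.Coprime r 6) :
    Nonempty (lensCoker 4 r ≃+
      ℤ × ZMod r × ZMod r × ZMod r × ZMod r) := by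
  exact ⟨((Submodule.quotEquivOfEq _ _
    (range_lensMatrix_four (Nat.one_le_iff_ne_zero.mp hr) hcop)).trans
    ((reduceTail r).quotKerEquivOfSurjective (reduceTail_surjective r))).toAddEquiv⟩
end
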